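/- Let 𝓛*, Ω, Φ = {φ_f : f ∈ Ω} be as follows: 𝓛* contains the polarity signature, and for n-ary f ∈ Ω, φ_f is an 𝓛*_n-formula with one free variable. Let P be an 𝓛*-structure based on a polarity, U an ultrafilter on a set I, and f ∈ Ω n-ary. Assume P⁺ is closed under f^P_{φ_f}, the stable set lattice (P^U)⁺ of the ultrapower P^U is closed under f^{P^U}_{φ_f}, and the restriction of f^{P^U}_{φ_f} to (P^U)⁺ is a complete normal dual operator (preserves arbitrary meets, including the empty meet, in each coordinate). Then this restriction is the upper MacNeille extension, along the embedding θ : (P⁺)^U → (P^U)⁺, of the coordinatewise ultrapower operation f^{(P⁺)^U}: for all A₀, …, A_{n−1} ∈ (P^U)⁺, f^{P^U}_{φ_f}(A₀, …, A_{n−1}) = ⋀{θ(f^{(P⁺)^U}(B₀, …, B_{n−1})) : each B_j ∈ (P⁺)^U and A_j ⊆ θ(B_j)}, the meet being taken in (P^U)⁺. -/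

import Mathlib

open FirstOrder FirstOrder.Language FirstOrder.Language.Structure

namespace PaperCore

/-! ### Typed polarities and stable set lattices -/

section Pol
variable {X Y : Type*}

def rho (R : X → Y → Prop) (A : Set X) : Set Y := {y | ∀ x ∈ A, R x y}

def lam (R : X → Y → Prop) (B : Set Y) : Set X := {x | ∀ y ∈ B, R x y}

def IsStable (R : X → Y → Prop) (A : Set X) : Prop := lam R (rho R A) ⊆ A

def IsStableY (R : X → Y → Prop) (B : Set Y) : Prop := rho R (lam R B) ⊆ B

lemma rho_anti {R : X → Y → Prop} {A B : Set X} (h : A ⊆ B) : rho R B ⊆ rho R A :=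
  fun y hy x hx => hy x (h hx)

lemma lam_anti {R : X → Y → Prop} {B B' : Set Y} (h : B ⊆ B') : lam R B' ⊆ lam R B :=
  fun x hx y hy => hx y (h hy)

lemma lamrho_mono {R : X → Y → Prop} {A B : Set X} (h : A ⊆ B) :
    lam R (rho R A) ⊆ lam R (rho R B) := lam_anti (rho_anti h)

def Stable (R : X → Y → Prop) : Type _ := {A : Set X // IsStable R A}

namespace Stable

variable {R : X → Y → Prop}

instance : PartialOrder (Stable R) :=
  inferInstanceAs (PartialOrder {A : Set X // IsStable R A})

lemma le_def {A B : Stable R} : A ≤ B ↔ A.1 ⊆ B.1 := Iff.rfl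

instance : InfSet (Stable R) :=
  ⟨fun S => ⟨⋂ A ∈ S, A.1, fun x hx => Set.mem_iInter₂.2 fun A hA =>
    A.2 (lamrho_mono (Set.biInter_subset_of_mem hA) hx)⟩⟩

instance : CompleteLattice (Stable R) :=
  completeLatticeOfInf _ (fun S =>
    ⟨fun A hA => Set.biInter_subset_of_mem hA,
     fun B hB => Set.subset_iInter₂ fun A hA => hB hA⟩)

end Stable
end Pol

/-! ### Ultraproducts of indexed families (as plain quotients) -/

section UProd
variable {I : Type*}

def uSetoid (U : Ultrafilter I) (β : I → Type*) : Setoid (∀ i, β i) where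
  r f g := {i | f i = g i} ∈ U
  iseqv := by
    refine ⟨fun f => ?_, fun {f g} h => ?_, fun {f g h} h1 h2 => ?_⟩
    · exact Filter.univ_mem' (fun i => rfl)
    · exact Filter.mem_of_superset h fun i hi => (hi : f i = g i).symm
    · exact Filter.mem_of_superset (Filter.inter_mem h1 h2) fun i hi =>
        (hi.1 : f i = g i).trans hi.2

def UProd (U : Ultrafilter I) (β : I → Type*) : Type _ := Quotient (uSetoid U β)

def uMk (U : Ultrafilter I) {β : I → Type*} (f : ∀ i, β i) : UProd U β :=
  Quotient.mk (uSetoid U β) f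

lemma uMk_surjective (U : Ultrafilter I) (β : I → Type*) :
    Function.Surjective (uMk U (β := β)) := Quotient.mk''_surjective

/-- `θ(α^U)`: the subset of the ultraproduct determined by a family of subsets. -/
def thetaSet (U : Ultrafilter I) {β : I → Type*} (α : ∀ i, Set (β i)) : Set (UProd U β) :=
  fun m => Quotient.liftOn m (fun f => {i | f i ∈ α i} ∈ U) (by
    intro f g hfg
    refine propext ⟨fun hf => ?_, fun hg => ?_⟩
    · exact Filter.mem_of_superset (Filter.inter_mem hf hfg) fun i hi =>
        show g i ∈ α i from hi.2 ▸ hi.1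
    · exact Filter.mem_of_superset (Filter.inter_mem hg hfg) fun i hi =>
        show f i ∈ α i from hi.2.symm ▸ hi.1)

lemma mem_thetaSet (U : Ultrafilter I) {β : I → Type*} (α : ∀ i, Set (β i)) (f : ∀ i, β i) :
    uMk U f ∈ thetaSet U α ↔ {i | f i ∈ α i} ∈ U := Iff.rfl

end UProd

/-! ### Completions: closed/open elements, density, compactness -/

section Completion
variable {C : Type*} [CompleteLattice C]

def ClosedElt (img : Set C) (c : C) : Prop := ∃ S ⊆ img, c = sInf S

def OpenElt (img : Set C) (c : C) : Prop := ∃ S ⊆ img, c = sSup S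

/-- The completion with image `img` is dense. -/
def DenseCompletion (img : Set C) : Prop :=
  ∀ x : C, (∃ G, (∀ c ∈ G, ClosedElt img c) ∧ x = sSup G) ∧
    (∃ G, (∀ o ∈ G, OpenElt img o) ∧ x = sInf G)

/-- The completion with image `img` is compact. -/
def CompactCompletion (img : Set C) : Prop :=
  ∀ S T : Set C, (∀ c ∈ S, ClosedElt img c) → (∀ o ∈ T, OpenElt img o) →
    sInf S ≤ sSup T →
      ∃ S' T' : Finset C, ↑S' ⊆ S ∧ ↑T' ⊆ T ∧ sInf (S' : Set C) ≤ sSup (T' : Set C)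

def JoinDense (img : Set C) : Prop := ∀ x : C, ∃ G ⊆ img, x = sSup G

def MeetDense (img : Set C) : Prop := ∀ x : C, ∃ G ⊆ img, x = sInf G

/-! Canonical and MacNeille extensions of `n`-ary isotone maps. -/

variable {L : Type*}

def lowerCanExt {n : ℕ} (η : L → C) (g : (Fin n → L) → L) (x : Fin n → C) : C :=
  sSup {z | ∃ p : Fin n → C, (∀ j, ClosedElt (Set.range η) (p j)) ∧ (∀ j, p j ≤ x j) ∧
    z = sInf {w | ∃ a : Fin n → L, (∀ j, p j ≤ η (a j)) ∧ w = η (g a)}}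

def upperCanExt {n : ℕ} (η : L → C) (g : (Fin n → L) → L) (x : Fin n → C) : C :=
  sInf {z | ∃ q : Fin n → C, (∀ j, OpenElt (Set.range η) (q j)) ∧ (∀ j, x j ≤ q j) ∧
    z = sSup {w | ∃ a : Fin n → L, (∀ j, η (a j) ≤ q j) ∧ w = η (g a)}}

def lowerMacExt {n : ℕ} (η : L → C) (g : (Fin n → L) → L) (x : Fin n → C) : C :=
  sSup {w | ∃ a : Fin n → L, (∀ j, η (a j) ≤ x j) ∧ w = η (g a)}

def upperMacExt {n : ℕ} (η : L → C) (g : (Fin n → L) → L) (x : Fin n → C) : C :=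
  sInf {w | ∃ a : Fin n → L, (∀ j, x j ≤ η (a j)) ∧ w = η (g a)}

/-- `F` preserves arbitrary joins (including the empty join) in each coordinate. -/
def CompleteNormalOp {n : ℕ} (F : (Fin n → C) → C) : Prop :=
  ∀ (as : Fin n → C) (j : Fin n) (G : Set C),
    F (Function.update as j (sSup G)) = ⨆ B ∈ G, F (Function.update as j B)

/-- `F` preserves arbitrary meets (including the empty meet) in each coordinate. -/
def CompleteNormalDualOp {n : ℕ} (F : (Fin n → C) → C) : Prop :=
  ∀ (as : Fin n → C) (j : Fin n) (G : Set C),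
    F (Function.update as j (sInf G)) = ⨅ B ∈ G, F (Function.update as j B)

end Completion

/-! ### First-order polarity-based structures and definable operations -/

section FO

/-- The language with `n` fresh unary relation symbols `S₀, …, S_{n-1}`. -/
def unaryLang (n : ℕ) : FirstOrder.Language where
  Functions := fun _ => Empty
  Relations := fun k => match k with
    | 1 => Fin n
    | _ => Empty

/-- The structure interpreting each `Sₘ` as `A m`. -/
def unaryStructure {M : Type*} {n : ℕ} (A : Fin n → Set M) : (unaryLang n).Structure M where
  funMap := fun {k} f _ => f.elim
  RelMap := fun {k} => match k with
    | 0 => fun r _ => r.elim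
    | 1 => fun r v => v 0 ∈ A r
    | (_ + 2) => fun r _ => r.elim

/-- The expansion `⟨P, A₀, …, A_{n-1}⟩` of a structure by `n` set parameters. -/
def withParams {L : FirstOrder.Language} {M : Type*} [L.Structure M] {n : ℕ}
    (A : Fin n → Set M) : (L.sum (unaryLang n)).Structure M :=
  letI := unaryStructure A
  inferInstance

variable {L : FirstOrder.Language} {M : Type*} [L.Structure M]

def pX (Xb : L.Relations 1) (M : Type*) [L.Structure M] : Set M := {m | RelMap Xb ![m]}

def pR (Rb : L.Relations 2) : M → M → Prop := fun a b => RelMap Rb ![a, b]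

/-- The operation on subsets of `X` defined by a formula `φ(v)` of `𝓛*_n`:
`f^P_φ(A₀,…,A_{n-1}) = {x ∈ X : ⟨P, A⟩ ⊨ φ[x]}`. -/
def defOp (Xb : L.Relations 1) {n : ℕ}
    (φ : (L.sum (unaryLang n)).Formula (Fin 1)) (A : Fin n → Set M) : Set M :=
  {x | x ∈ pX Xb M ∧ @Formula.Realize _ M (withParams A) _ φ (fun _ => x)}

/-- Set-based polarity data inside a one-sorted universe. -/
def rhoS (Yset : Set M) (R : M → M → Prop) (A : Set M) : Set M :=
  {y | y ∈ Yset ∧ ∀ x ∈ A, R x y}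

def lamS (Xset : Set M) (R : M → M → Prop) (B : Set M) : Set M :=
  {x | x ∈ Xset ∧ ∀ y ∈ B, R x y}

def IsStableS (Xset Yset : Set M) (R : M → M → Prop) (A : Set M) : Prop :=
  A ⊆ Xset ∧ lamS Xset R (rhoS Yset R A) ⊆ A

def StableS (Xset Yset : Set M) (R : M → M → Prop) : Type _ :=
  {A : Set M // IsStableS Xset Yset R A}

namespace StableS

variable {Xset Yset : Set M} {R : M → M → Prop}

lemma lamS_subset (B : Set M) : lamS Xset R B ⊆ Xset := fun _ hx => hx.1

lemma rhoS_anti {A B : Set M} (h : A ⊆ B) : rhoS Yset R B ⊆ rhoS Yset R A :=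
  fun y hy => ⟨hy.1, fun x hx => hy.2 x (h hx)⟩

lemma lamS_anti {B B' : Set M} (h : B ⊆ B') : lamS Xset R B' ⊆ lamS Xset R B :=
  fun x hx => ⟨hx.1, fun y hy => hx.2 y (h hy)⟩

lemma lamrhoS_mono {A B : Set M} (h : A ⊆ B) :
    lamS Xset R (rhoS Yset R A) ⊆ lamS Xset R (rhoS Yset R B) :=
  lamS_anti (rhoS_anti (Yset := Yset) h)

instance : PartialOrder (StableS Xset Yset R) :=
  inferInstanceAs (PartialOrder {A : Set M // IsStableS Xset Yset R A})

lemma le_def {A B : StableS Xset Yset R} : A ≤ B ↔ A.1 ⊆ B.1 := Iff.rfl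

instance : InfSet (StableS Xset Yset R) :=
  ⟨fun S => ⟨Xset ∩ ⋂ A ∈ S, A.1,
    ⟨Set.inter_subset_left, fun x hx =>
      ⟨(lamS_subset _) hx, Set.mem_iInter₂.2 fun A hA =>
        A.2.2 (lamrhoS_mono (Set.inter_subset_right.trans (Set.biInter_subset_of_mem hA)) hx)⟩⟩⟩⟩

instance : CompleteLattice (StableS Xset Yset R) :=
  completeLatticeOfInf _ (fun S =>
    ⟨fun A hA => (Set.inter_subset_right.trans (Set.biInter_subset_of_mem hA) :
        Xset ∩ ⋂ A ∈ S, A.1 ⊆ A.1),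
     fun B hB => Set.subset_inter B.2.1 (Set.subset_iInter₂ fun A hA => hB hA)⟩)

end StableS

end FO

end PaperCore

namespace PaperCore
section FO2
variable {I : Type*}

/-- `f^U`: the element of the ultraproduct determined by `f ∈ ∏_I M_i`. -/
def pmk (U : Ultrafilter I) {M : I → Type*} (f : ∀ i, M i) : (U : Filter I).Product M :=
  Quotient.mk (Filter.productSetoid (U : Filter I) M) f

/-- `θ(α^U) = {f^U ∈ ∏_U M_i : {i : f(i) ∈ α(i)} ∈ U}`. -/
def thetaSetP (U : Ultrafilter I) {M : I → Type*} (α : ∀ i, Set (M i)) :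
    Set ((U : Filter I).Product M) :=
  fun m => Quotient.liftOn (s := Filter.productSetoid (U : Filter I) M) m
    (fun f => {i | f i ∈ α i} ∈ U) (by
      intro f g hfg
      have hfg' : {i | f i = g i} ∈ U := hfg
      refine propext ⟨fun hf => ?_, fun hg => ?_⟩
      · exact Filter.mem_of_superset (Filter.inter_mem hf hfg') fun i hi =>
          show g i ∈ α i from hi.2 ▸ hi.1
      · exact Filter.mem_of_superset (Filter.inter_mem hg hfg') fun i hi =>
          show f i ∈ α i from hi.2.symm ▸ hi.1)

lemma mem_thetaSetP (U : Ultrafilter I) {M : I → Type*} (α : ∀ i, Set (M i)) (f : ∀ i, M i) :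
    pmk U f ∈ thetaSetP U α ↔ {i | f i ∈ α i} ∈ U := Iff.rfl

/-- The ultrapower `P^U` of a single universe `M`. -/
abbrev UPow (U : Ultrafilter I) (M : Type*) : Type _ := (U : Filter I).Product (fun _ : I => M)

/-- The stable set lattice `P⁺` of a polarity-based `𝓛*`-structure `M`. -/
abbrev StabFO {L : FirstOrder.Language} (Xb Yb : L.Relations 1) (Rb : L.Relations 2)
    (M : Type*) [L.Structure M] : Type _ :=
  StableS (pX Xb M) (pX Yb M) (pR (M := M) Rb)

end FO2
end PaperCore

namespace PaperCore

section DualOperators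
variable {C : Type*} [CompleteLattice C] {n : ℕ} {F : (Fin n → C) → C}

lemma CompleteNormalDualOp.monotone_update (hF : CompleteNormalDualOp F) (A : Fin n → C)
    (j : Fin n) {b c : C} (hbc : b ≤ c) :
    F (Function.update A j b) ≤ F (Function.update A j c) := by
  have h := hF A j {b, c}
  rw [sInf_pair, inf_eq_left.2 hbc, iInf_pair] at h
  exact h ▸ inf_le_right

lemma CompleteNormalDualOp.monotone (hF : CompleteNormalDualOp F) : Monotone F := by
  intro A B hAB
  have key : ∀ s : Finset (Fin n), F A ≤ F (s.piecewise B A) := by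
    intro s
    induction s using Finset.induction_on with
    | empty => simp
    | insert j s hj ih =>
      refine ih.trans ?_
      rw [Finset.piecewise_insert]
      conv_lhs => rw [← Function.update_eq_self j (s.piecewise B A)]
      refine hF.monotone_update _ j ?_
      rw [Finset.piecewise_eq_of_notMem _ _ _ hj]
      exact hAB j
  simpa using key Finset.univ

/-- A complete normal dual operator turns coordinatewise meets into a single meet. -/
lemma CompleteNormalDualOp.map_sInf (hF : CompleteNormalDualOp F) (G : Fin n → Set C) :
    F (fun j => sInf (G j)) = ⨅ B ∈ Set.univ.pi G, F B := by
  refine le_antisymm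
    (le_iInf₂ fun B hB => hF.monotone fun j => sInf_le (hB j trivial)) ?_
  have key : ∀ s : Finset (Fin n), ∀ B : Fin n → C, (∀ j ∈ s, B j = sInf (G j)) →
      (∀ j ∉ s, B j ∈ G j) → ⨅ B ∈ Set.univ.pi G, F B ≤ F B := by
    intro s
    induction s using Finset.induction_on with
    | empty => exact fun B _ hB => iInf₂_le B fun j _ => hB j (Finset.notMem_empty j)
    | insert j s hj ih =>
      intro B hs hns
      rw [← Function.update_eq_self j B, hs j (Finset.mem_insert_self j s), hF]
      refine le_iInf₂ fun b hb => ih _ (fun k hk => ?_) fun k hk => ?_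
      · have hkj : k ≠ j := fun h => hj (h ▸ hk)
        rw [Function.update_of_ne hkj]
        exact hs k (Finset.mem_insert_of_mem hk)
      · by_cases hkj : k = j
        · subst hkj
          rwa [Function.update_self]
        · rw [Function.update_of_ne hkj]
          exact hns k (by simp [hkj, hk])
  exact key Finset.univ _ (fun _ _ => rfl) fun j hj => absurd (Finset.mem_univ j) hj

end DualOperators

section Los
variable {L : FirstOrder.Language} {I : Type*} {U : Ultrafilter I}

lemma pmk_surjective {M : I → Type*} (x : (U : Filter I).Product M) : ∃ f, pmk U f = x :=
  Quotient.exists_rep x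

lemma relMap_pmk {M : I → Type*} [∀ i, L.Structure (M i)] [∀ i, Nonempty (M i)] {k : ℕ}
    (r : L.Relations k) (x : Fin k → ∀ i, M i) :
    RelMap r (fun j => pmk U (x j)) ↔ ∀ᶠ i in (U : Filter I), RelMap r fun j => x j i := by
  have h := Ultraproduct.realize_formula_cast (u := U) (r.formula fun j => (Term.var j)) x
  simp only [Formula.realize_rel, Term.realize_var] at h
  exact h

variable {M : Type*} [L.Structure M] [Nonempty M]

lemma pmk_mem_pX (Xb : L.Relations 1) (f : I → M) :
    pmk U f ∈ pX Xb (UPow U M) ↔ ∀ᶠ i in (U : Filter I), f i ∈ pX Xb M := by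
  have h := relMap_pmk (U := U) Xb ![f]
  have e : (fun j => pmk U ((![f] : Fin 1 → I → M) j)) = ![pmk U f] := by
    funext j; fin_cases j; rfl
  have e' : ∀ i, (fun j => (![f] : Fin 1 → I → M) j i) = ![f i] := by
    intro i; funext j; fin_cases j; rfl
  simp only [e, e'] at h
  exact h

lemma pR_pmk (Rb : L.Relations 2) (f g : I → M) :
    pR Rb (pmk U f : UPow U M) (pmk U g) ↔ ∀ᶠ i in (U : Filter I), pR Rb (f i) (g i) := by
  have h := relMap_pmk (U := U) Rb ![f, g]
  have e : (fun j => pmk U ((![f, g] : Fin 2 → I → M) j)) = ![pmk U f, pmk U g] := by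
    funext j; fin_cases j <;> rfl
  have e' : ∀ i, (fun j => (![f, g] : Fin 2 → I → M) j i) = ![f i, g i] := by
    intro i; funext j; fin_cases j <;> rfl
  simp only [e, e'] at h
  exact h

/-- The expansion of the ultrapower by `θ`-images is the ultraproduct of the expansions. -/
lemma withParams_thetaSetP {n : ℕ} (A : Fin n → I → Set M) :
    withParams (L := L) (M := UPow U M) (fun j => thetaSetP U (A j)) =
      @Ultraproduct.structure I (fun _ => M) U (L.sum (unaryLang n))
        (fun i => withParams fun j => A j i) := by
  let this : ∀ _ : I, (L.sum (unaryLang n)).Structure M := fun i => withParams fun j => A j i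
  refine Structure.ext ?_ ?_
  · funext k f x
    choose y hy using fun j => pmk_surjective (x j)
    obtain rfl : (fun j => pmk U (y j)) = x := funext hy
    refine Eq.trans ?_ (@Ultraproduct.funMap_cast I (fun _ => M) U _ this k f y).symm
    cases f with
    | inl f => exact Ultraproduct.funMap_cast (M := fun _ => M) f y
    | inr f => exact f.elim
  · funext k r x
    choose y hy using fun j => pmk_surjective (x j)
    obtain rfl : (fun j => pmk U (y j)) = x := funext hy
    refine Eq.trans ?_
      (propext (@relMap_pmk _ I U (fun _ => M) this _ k r y)).symm
    cases r with
    | inl r => exact propext (relMap_pmk (M := fun _ => M) r y)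
    | inr r =>
      match k, r with
      | 0, r => exact r.elim
      | 1, r => rfl
      | k + 2, r => exact r.elim

lemma realize_withParams_pmk {n : ℕ} (φ : (L.sum (unaryLang n)).Formula (Fin 1))
    (A : Fin n → I → Set M) (f : I → M) :
    @Formula.Realize _ (UPow U M) (withParams fun j => thetaSetP U (A j)) _ φ
        (fun _ => pmk U f) ↔
      ∀ᶠ i in (U : Filter I),
        @Formula.Realize _ M (withParams fun j => A j i) _ φ (fun _ => f i) := by
  rw [withParams_thetaSetP]
  exact @Ultraproduct.realize_formula_cast I (fun _ => M) U _
    (fun i => withParams fun j => A j i) _ _ φ fun _ => f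

lemma defOp_thetaSetP (Xb : L.Relations 1) {n : ℕ}
    (φ : (L.sum (unaryLang n)).Formula (Fin 1)) (A : Fin n → I → Set M) :
    defOp (M := UPow U M) Xb φ (fun j => thetaSetP U (A j)) =
      thetaSetP U fun i => defOp Xb φ fun j => A j i := by
  ext x
  obtain ⟨f, rfl⟩ := pmk_surjective x
  refine (and_congr (pmk_mem_pX Xb f) (realize_withParams_pmk φ A f)).trans ?_
  exact Filter.eventually_and.symm

end Los

section Density

lemma isStableS_lamS {M : Type*} {Xset Yset : Set M} {R : M → M → Prop} {B : Set M}
    (hB : B ⊆ Yset) : IsStableS Xset Yset R (lamS Xset R B) :=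
  ⟨StableS.lamS_subset B, fun _ hx => ⟨hx.1, fun y hy => hx.2 y ⟨hB hy, fun _ hz => hz.2 y hy⟩⟩⟩

variable {L : FirstOrder.Language} {I : Type*} {U : Ultrafilter I}
  {M : Type*} [L.Structure M] [Nonempty M]

/-- The `θ`-images are meet-dense among the stable sets of an ultrapower. -/
lemma sInf_thetaSetP_eq {Xb Yb : L.Relations 1} {Rb : L.Relations 2}
    {θ : UProd U (fun _ : I => StabFO Xb Yb Rb M) → StabFO Xb Yb Rb (UPow U M)}
    (hθ : ∀ β : I → StabFO Xb Yb Rb M,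
      (θ (uMk U β)).1 = thetaSetP U (fun i => (β i).1))
    (A : StabFO Xb Yb Rb (UPow U M)) :
    sInf {B | A ≤ B ∧ ∃ β, B = θ (uMk U β)} = A := by
  refine le_antisymm ?_ (le_sInf fun B hB => hB.1)
  intro x hx
  refine A.2.2 ⟨hx.1, fun y hy => ?_⟩
  obtain ⟨f, rfl⟩ := pmk_surjective x
  obtain ⟨g, rfl⟩ := pmk_surjective y
  have hg := (pmk_mem_pX Yb g).1 hy.1
  let β : I → StabFO Xb Yb Rb M := fun i =>
    ⟨lamS (pX Xb M) (pR Rb) {y | y ∈ pX Yb M ∧ y = g i}, isStableS_lamS fun _ h => h.1⟩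
  have hA : A ≤ θ (uMk U β) := by
    intro z hz
    rw [hθ]
    have hzX := A.2.1 hz
    have hzR := hy.2 z hz
    obtain ⟨h, rfl⟩ := pmk_surjective z
    filter_upwards [(pmk_mem_pX Xb h).1 hzX, (pR_pmk Rb h g).1 hzR] with i hi hR
    exact ⟨hi, by rintro _ ⟨-, rfl⟩; exact hR⟩
  have hxβ : pmk U f ∈ (θ (uMk U β)).1 := Set.mem_iInter₂.1 hx.2 _ ⟨hA, β, rfl⟩
  rw [hθ] at hxβ
  refine (pR_pmk Rb f g).2 ?_
  filter_upwards [hg, hxβ] with i hi hf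
  exact hf.2 _ ⟨hi, rfl⟩

end Density

end PaperCore

open PaperCore in
/-- Lemma 4.2(2) of the paper: if the operation on `(P^U)⁺` defined by `φ`
is a complete normal dual operator, then it is the upper MacNeille extension, along the
embedding `θ : (P⁺)^U → (P^U)⁺`, of the coordinatewise ultrapower operation. -/
theorem statement3 {L : FirstOrder.Language} (Xb Yb : L.Relations 1) (Rb : L.Relations 2)
    {M : Type*} [L.Structure M] [Nonempty M]
    (hcover : ∀ m : M, RelMap Xb ![m] ∨ RelMap Yb ![m])
    (htype : ∀ a b : M, RelMap Rb ![a, b] → RelMap Xb ![a] ∧ RelMap Yb ![b])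
    {I : Type*} (U : Ultrafilter I)
    {n : ℕ} (φ : (L.sum (unaryLang n)).Formula (Fin 1))
    (hclosP : ∀ As : Fin n → StabFO Xb Yb Rb M,
      IsStableS (pX Xb M) (pX Yb M) (pR Rb) (defOp Xb φ fun j => (As j).1))
    (hclosU : ∀ As : Fin n → StabFO Xb Yb Rb (UPow U M),
      IsStableS (pX Xb (UPow U M)) (pX Yb (UPow U M)) (pR Rb)
        (defOp Xb φ fun j => (As j).1))
    (θ : UProd U (fun _ : I => StabFO Xb Yb Rb M) → StabFO Xb Yb Rb (UPow U M))
    (hθ : ∀ β : I → StabFO Xb Yb Rb M,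
      (θ (uMk U β)).1 = thetaSetP U (fun i => (β i).1))
    (hop : CompleteNormalDualOp (fun As : Fin n → StabFO Xb Yb Rb (UPow U M) =>
      (⟨defOp Xb φ fun j => (As j).1, hclosU As⟩ : StabFO Xb Yb Rb (UPow U M)))) :
    ∀ As : Fin n → StabFO Xb Yb Rb (UPow U M),
      (⟨defOp Xb φ fun j => (As j).1, hclosU As⟩ : StabFO Xb Yb Rb (UPow U M)) =
        sInf {Cc : StabFO Xb Yb Rb (UPow U M) |
          ∃ βs : Fin n → (I → StabFO Xb Yb Rb M),
            (∀ j, As j ≤ θ (uMk U (βs j))) ∧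
            Cc = θ (uMk U (fun i => (⟨defOp Xb φ fun j => (βs j i).1,
              hclosP (fun j => βs j i)⟩ : StabFO Xb Yb Rb M)))} := by
  intro As
  have hcomm : ∀ βs : Fin n → I → StabFO Xb Yb Rb M,
      θ (uMk U (fun i => (⟨defOp Xb φ fun j => (βs j i).1,
        hclosP (fun j => βs j i)⟩ : StabFO Xb Yb Rb M))) =
      ⟨defOp Xb φ fun j => (θ (uMk U (βs j))).1, hclosU fun j => θ (uMk U (βs j))⟩ := by
    intro βs
    refine Subtype.ext ((hθ _).trans ?_)
    simp only [hθ]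
    exact (defOp_thetaSetP Xb φ fun j i => (βs j i).1).symm
  have h := hop.map_sInf fun j => {B | As j ≤ B ∧ ∃ β, B = θ (uMk U β)}
  simp only [sInf_thetaSetP_eq hθ] at h
  refine h.trans (le_antisymm (α := StabFO Xb Yb Rb (UPow U M)) (le_sInf ?_) (le_iInf₂ fun B hB => ?_))
  · rintro _ ⟨βs, hβs, rfl⟩
    rw [hcomm]
    exact iInf₂_le (fun j => θ (uMk U (βs j))) fun j _ => ⟨hβs j, βs j, rfl⟩
  · choose hle βs hβs using fun j => hB j trivial
    obtain rfl : B = fun j => θ (uMk U (βs j)) := funext hβs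
    exact sInf_le ⟨βs, hle, (hcomm βs).symm⟩
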